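/- arXiv:2010.15291 — 2 statements merged into one kernel-verified Lean document; each statement's English description precedes it below -/
import Mathlib

section
/- The analogue of the initial-segment theorem fails for k = 3: L(3) is a proper subset of L ∩ (−∞, √21], i.e. there exists x ∈ L with x ≤ √21 = √(3²+4·3) and x ∉ L(3). -/
open Filter Set
open scoped Pointwise

noncomputable section

/-- The `n`-th convergent of the continued fraction `[0; a 0, a 1, a 2, …]`. -/
def cfConv : ℕ → (ℕ → ℕ) → ℝ
  | 0, _ => 0
  | n + 1, a => 1 / (a 0 + cfConv n fun i => a (i + 1))

/-- The value `[0; a 0, a 1, a 2, …]` of the infinite continued fraction with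
partial quotients `a 0, a 1, …` (the limit of its convergents). -/
def cfVal (a : ℕ → ℕ) : ℝ := limUnder atTop fun n => cfConv n a

/-- The sequence of partial quotients obtained by concatenating the finite word `b`
with the sequence `θ`. -/
def app (b : List ℕ) (θ : ℕ → ℕ) : ℕ → ℕ := fun n =>
  if h : n < b.length then b.get ⟨n, h⟩ else θ (n - b.length)

/-- `λ_i(θ) = [a_i; a_{i+1}, …] + [0; a_{i-1}, a_{i-2}, …]` for a bi-infinite
sequence `θ` of partial quotients. -/
def lamCF (θ : ℤ → ℕ) (i : ℤ) : ℝ :=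
  (θ i : ℝ) + cfVal (fun n => θ (i + 1 + n)) + cfVal (fun n => θ (i - 1 - n))

/-- The classical Lagrange spectrum. -/
def LSpec : Set ℝ :=
  {x | ∃ θ : ℤ → ℕ, (∀ i, 1 ≤ θ i) ∧
    IsBoundedUnder (· ≤ ·) atTop (lamCF θ) ∧ x = limsup (lamCF θ) atTop}

/-- The classical Markov spectrum. -/
def MSpec : Set ℝ :=
  {x | ∃ θ : ℤ → ℕ, (∀ i, 1 ≤ θ i) ∧
    BddAbove (Set.range (lamCF θ)) ∧ x = ⨆ i, lamCF θ i}

/-- The Lagrange spectrum `L(k)` of sequences with partial quotients in `{1, …, k}`. -/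
def LSpecK (k : ℕ) : Set ℝ :=
  {x | ∃ θ : ℤ → ℕ, (∀ i, 1 ≤ θ i ∧ θ i ≤ k) ∧ x = limsup (lamCF θ) atTop}

/-- The Markov spectrum `M(k)` of sequences with partial quotients in `{1, …, k}`. -/
def MSpecK (k : ℕ) : Set ℝ :=
  {x | ∃ θ : ℤ → ℕ, (∀ i, 1 ≤ θ i ∧ θ i ≤ k) ∧ x = ⨆ i, lamCF θ i}

theorem cfConv_mem_Icc (n : ℕ) : ∀ a : ℕ → ℕ, (∀ i, 1 ≤ a i) → cfConv n a ∈ Icc (0 : ℝ) 1 := by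
  induction n with
  | zero => intro a _; simp [cfConv]
  | succ n ih =>
    intro a ha
    obtain ⟨h0, -⟩ := ih (fun i => a (i + 1)) fun i => ha _
    have h1 : (1 : ℝ) ≤ a 0 := mod_cast ha 0
    rw [cfConv]
    exact ⟨by positivity, (div_le_one (by positivity)).2 (by linarith)⟩

/-- Two steps of the continued fraction algorithm contract distances by a factor of `4`. -/
theorem abs_one_div_add_one_div_sub_le {a b x y : ℝ} (ha : 1 ≤ a) (hb : 1 ≤ b) (hx : 0 ≤ x)
    (hy : 0 ≤ y) :
    |1 / (a + 1 / (b + x)) - 1 / (a + 1 / (b + y))| ≤ |x - y| / 4 := by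
  have hab : 1 ≤ a * b := one_le_mul_of_one_le_of_one_le ha hb
  have hax : 0 ≤ a * x := by positivity
  have hay : 0 ≤ a * y := by positivity
  have hP : 4 ≤ (a * (b + x) + 1) * (a * (b + y) + 1) := by nlinarith
  have key : 1 / (a + 1 / (b + x)) - 1 / (a + 1 / (b + y)) =
      (x - y) / ((a * (b + x) + 1) * (a * (b + y) + 1)) := by
    have : b + x ≠ 0 := by positivity
    have : b + y ≠ 0 := by positivity
    have : a * (b + x) + 1 ≠ 0 := by positivity
    have : a * (b + y) + 1 ≠ 0 := by positivity
    field_simp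
    ring
  rw [key, abs_div, abs_of_pos (by linarith : 0 < (a * (b + x) + 1) * (a * (b + y) + 1))]
  gcongr

theorem abs_cfConv_sub_le (k : ℕ) : ∀ (a : ℕ → ℕ), (∀ i, 1 ≤ a i) → ∀ m n : ℕ,
    |cfConv (m + 2 * k) a - cfConv (n + 2 * k) a| ≤ (1 / 4) ^ k := by
  induction k with
  | zero =>
    intro a ha m n
    obtain ⟨h1, h2⟩ := cfConv_mem_Icc m a ha
    obtain ⟨h3, h4⟩ := cfConv_mem_Icc n a ha
    simpa using abs_sub_le_iff.2 ⟨by linarith, by linarith⟩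
  | succ k ih =>
    intro a ha m n
    have ha' : ∀ i, 1 ≤ a (i + 1 + 1) := fun i => ha _
    refine (abs_one_div_add_one_div_sub_le (mod_cast ha 0) (mod_cast ha (0 + 1))
      (cfConv_mem_Icc (m + 2 * k) _ ha').1 (cfConv_mem_Icc (n + 2 * k) _ ha').1).trans ?_
    have := ih (fun i => a (i + 1 + 1)) ha' m n
    rw [pow_succ]
    linarith

theorem tendsto_cfConv {a : ℕ → ℕ} (ha : ∀ i, 1 ≤ a i) :
    Tendsto (fun n => cfConv n a) atTop (nhds (cfVal a)) := by
  refine CauchySeq.tendsto_limUnder (Metric.cauchySeq_iff.2 fun ε hε => ?_)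
  obtain ⟨k, hk⟩ := exists_pow_lt_of_lt_one hε (by norm_num : (1 / 4 : ℝ) < 1)
  refine ⟨2 * k, fun m hm n hn => ?_⟩
  obtain ⟨m, rfl⟩ := Nat.exists_eq_add_of_le' hm
  obtain ⟨n, rfl⟩ := Nat.exists_eq_add_of_le' hn
  exact (abs_cfConv_sub_le k a ha m n).trans_lt hk

theorem cfVal_mem_Icc {a : ℕ → ℕ} (ha : ∀ i, 1 ≤ a i) : cfVal a ∈ Icc (0 : ℝ) 1 :=
  isClosed_Icc.mem_of_tendsto (tendsto_cfConv ha) (.of_forall fun n => cfConv_mem_Icc n a ha)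

theorem cfVal_eq {a : ℕ → ℕ} (ha : ∀ i, 1 ≤ a i) :
    cfVal a = 1 / (a 0 + cfVal fun i => a (i + 1)) := by
  have ha' : ∀ i, 1 ≤ a (i + 1) := fun i => ha _
  have h0 := (cfVal_mem_Icc ha').1
  have h1 : (1 : ℝ) ≤ a 0 := mod_cast ha 0
  have h := (tendsto_cfConv ha').const_add (a 0 : ℝ)
  exact tendsto_nhds_unique ((tendsto_add_atTop_iff_nat 1).2 (tendsto_cfConv ha))
    (tendsto_const_nhds.div h (by positivity))

/-- Rational bounds for the tail of a continued fraction yield bounds for its value. -/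
theorem cfVal_mem_Icc_of_tail {a : ℕ → ℕ} (ha : ∀ i, 1 ≤ a i) {d : ℕ} (hd : a 0 = d) {p q : ℝ}
    (hp : 0 ≤ p) (h : cfVal (fun i => a (i + 1)) ∈ Icc p q) :
    cfVal a ∈ Icc (1 / (d + q)) (1 / (d + p)) := by
  have h1 : (1 : ℝ) ≤ d := by rw [← hd]; exact mod_cast ha 0
  rw [cfVal_eq ha, hd]
  obtain ⟨h2, h3⟩ := h
  have h4 : 0 < d + cfVal fun i => a (i + 1) := by linarith
  constructor <;> gcongr

/-- The digits `1, 3, 1, 3, …` maximise continued fractions with partial quotients at most `3`. -/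
theorem cfConv_two_mul_le (n : ℕ) : ∀ a : ℕ → ℕ, (∀ i, 1 ≤ a i ∧ a i ≤ 3) →
    cfConv (2 * n) a ≤ (√21 - 3) / 2 := by
  have hs : (√21) ^ 2 = 21 := Real.sq_sqrt (by norm_num)
  have hs4 : 4 < √21 := Real.lt_sqrt_of_sq_lt (by norm_num)
  obtain ⟨M, hM⟩ : ∃ M, M = (√21 - 3) / 2 := ⟨_, rfl⟩
  have hM0 : 0 < M := by linarith
  have hM2 : M ^ 2 + 3 * M = 3 := by rw [hM]; linarith
  rw [← hM]
  induction n with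
  | zero => intro a _; exact hM0.le
  | succ n ih =>
    intro a ha
    have h := ih (fun i => a (i + 1 + 1)) fun i => ha _
    have h0 := (cfConv_mem_Icc (2 * n) (fun i => a (i + 1 + 1)) fun i => (ha _).1).1
    have ha0 : (1 : ℝ) ≤ a 0 := mod_cast (ha 0).1
    have ha1 : (1 : ℝ) ≤ a (0 + 1) := mod_cast (ha _).1
    have ha3 : (a (0 + 1) : ℝ) ≤ 3 := mod_cast (ha _).2
    calc cfConv (2 * (n + 1)) a
        = 1 / (a 0 + 1 / (a (0 + 1) + cfConv (2 * n) fun i => a (i + 1 + 1))) := rfl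
      _ ≤ 1 / (1 + 1 / (3 + M)) := by gcongr
      _ = M := by
        field_simp
        linarith

theorem cfVal_le_of_le_three {a : ℕ → ℕ} (ha : ∀ i, 1 ≤ a i ∧ a i ≤ 3) :
    cfVal a ≤ (√21 - 3) / 2 :=
  le_of_tendsto ((tendsto_cfConv fun i => (ha i).1).comp
    (tendsto_id.const_mul_atTop' (by norm_num : 0 < 2)))
    (.of_forall fun n => cfConv_two_mul_le n a ha)

theorem lamCF_le_sqrt {θ : ℤ → ℕ} (hθ : ∀ i, 1 ≤ θ i ∧ θ i ≤ 3) (i : ℤ) :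
    lamCF θ i ≤ √21 := by
  have h : (θ i : ℝ) ≤ 3 := mod_cast (hθ i).2
  have h1 := cfVal_le_of_le_three (a := fun n : ℕ => θ (i + 1 + n)) fun n => hθ _
  have h2 := cfVal_le_of_le_three (a := fun n : ℕ => θ (i - 1 - n)) fun n => hθ _
  rw [lamCF]
  linarith

theorem lamCF_nonneg {θ : ℤ → ℕ} (hθ : ∀ i, 1 ≤ θ i) (i : ℤ) : 0 ≤ lamCF θ i :=
  add_nonneg (add_nonneg (Nat.cast_nonneg _) (cfVal_mem_Icc fun _ => hθ _).1)
    (cfVal_mem_Icc fun _ => hθ _).1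

theorem isBoundedUnder_lamCF_of_le_three {θ : ℤ → ℕ} (hθ : ∀ i, 1 ≤ θ i ∧ θ i ≤ 3) :
    IsBoundedUnder (· ≤ ·) atTop (lamCF θ) :=
  isBoundedUnder_of ⟨_, lamCF_le_sqrt hθ⟩

theorem isCoboundedUnder_lamCF {θ : ℤ → ℕ} (hθ : ∀ i, 1 ≤ θ i) :
    IsCoboundedUnder (· ≤ ·) atTop (lamCF θ) :=
  (isBoundedUnder_of (r := (· ≥ ·)) ⟨0, lamCF_nonneg hθ⟩).isCoboundedUnder_le

theorem LSpecK_three_subset : LSpecK 3 ⊆ LSpec ∩ Iic (√21) := by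
  rintro x ⟨θ, hθ, rfl⟩
  have hco := isCoboundedUnder_lamCF fun i => (hθ i).1
  exact ⟨⟨θ, fun i => (hθ i).1, isBoundedUnder_lamCF_of_le_three hθ, rfl⟩,
    limsup_le_of_le hco (.of_forall (lamCF_le_sqrt hθ))⟩

theorem cfVal_mem_Icc_of_le_three {a : ℕ → ℕ} (ha : ∀ i, 1 ≤ a i ∧ a i ≤ 3) :
    cfVal a ∈ Icc (5 / 19 : ℝ) (19 / 24) := by
  have step : ∀ p q : ℝ, 0 ≤ p → (∀ b : ℕ → ℕ, (∀ i, 1 ≤ b i ∧ b i ≤ 3) → cfVal b ∈ Icc p q) →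
      ∀ b : ℕ → ℕ, (∀ i, 1 ≤ b i ∧ b i ≤ 3) → cfVal b ∈ Icc (1 / (3 + q)) (1 / (1 + p)) := by
    intro p q hp h b hb
    obtain ⟨h1, h2⟩ := h (fun i => b (i + 1)) fun i => hb _
    have h3 : (1 : ℝ) ≤ b 0 := mod_cast (hb 0).1
    have h4 : (b 0 : ℝ) ≤ 3 := mod_cast (hb 0).2
    rw [cfVal_eq fun i => (hb i).1]
    constructor <;> gcongr
    linarith
  have h := step _ _ (by norm_num) (step _ _ (by norm_num) (step _ _ (by norm_num)
    (step _ _ le_rfl fun b hb => cfVal_mem_Icc fun i => (hb i).1))) a ha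
  norm_num at h ⊢
  exact ⟨by linarith [h.1], by linarith [h.2]⟩

/-- A gap in the set of continued fractions with partial quotients at most `3`. -/
theorem cfVal_gap_of_le_three {a : ℕ → ℕ} (ha : ∀ i, 1 ≤ a i ∧ a i ≤ 3) :
    cfVal a ≤ 7364 / 10000 ∨ 7654 / 10000 ≤ cfVal a := by
  have ha1 : ∀ i, 1 ≤ a i := fun i => (ha i).1
  have htail := cfVal_mem_Icc_of_le_three (a := fun i => a (i + 1 + 1)) fun i => ha _
  have h1 := cfVal_mem_Icc_of_tail (fun i => ha1 (i + 1)) rfl (by norm_num) htail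
  have h0 := cfVal_mem_Icc_of_tail ha1 rfl (by positivity) h1
  obtain ⟨h01, h03⟩ := ha 0
  obtain ⟨h11, h13⟩ := ha (0 + 1)
  generalize a 0 = c, a (0 + 1) = d at h0 h01 h03 h11 h13
  interval_cases c <;> interval_cases d <;> norm_num at h0 <;>
    first
    | exact Or.inl (by linarith [h0.2])
    | exact Or.inr (by linarith [h0.1])

theorem lamCF_gap_of_le_three {θ : ℤ → ℕ} (hθ : ∀ i, 1 ≤ θ i ∧ θ i ≤ 3) (i : ℤ) :
    lamCF θ i ≤ 4.5281 ∨ 4.5308 ≤ lamCF θ i := by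
  have u1 := (cfVal_mem_Icc_of_le_three (a := fun n : ℕ => θ (i + 1 + n)) fun n => hθ _).2
  have u2 := (cfVal_mem_Icc_of_le_three (a := fun n : ℕ => θ (i - 1 - n)) fun n => hθ _).2
  have g1 := cfVal_gap_of_le_three (a := fun n : ℕ => θ (i + 1 + n)) fun n => hθ _
  have g2 := cfVal_gap_of_le_three (a := fun n : ℕ => θ (i - 1 - n)) fun n => hθ _
  rw [lamCF]
  obtain h3 | h3 := (hθ i).2.eq_or_lt
  · rw [h3]
    norm_num
    rcases g1 with g1 | g1
    · left; linarith
    rcases g2 with g2 | g2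
    · left; linarith
    · right; linarith
  · have h2 : (θ i : ℝ) ≤ 2 := mod_cast Nat.lt_succ_iff.1 h3
    left
    norm_num
    linarith

theorem notMem_LSpecK_three {x : ℝ} (h1 : 4.5281 < x) (h2 : x < 4.5308) : x ∉ LSpecK 3 := by
  rintro ⟨θ, hθ, rfl⟩
  have hco := isCoboundedUnder_lamCF fun i => (hθ i).1
  by_cases h : ∃ᶠ i in atTop, 4.5308 ≤ lamCF θ i
  · exact h2.not_ge (le_limsup_of_frequently_le h (isBoundedUnder_lamCF_of_le_three hθ))
  · refine h1.not_ge (limsup_le_of_le hco ?_)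
    filter_upwards [not_frequently.1 h] with i hi
    exact (lamCF_gap_of_le_three hθ i).resolve_right hi

/-- The purely periodic bi-infinite sequence with period `4, 4, 3, 2, 1, 2, 3`. -/
def perSeq (i : ℤ) : ℕ :=
  if i % 7 = 0 ∨ i % 7 = 1 then 4 else
  if i % 7 = 2 ∨ i % 7 = 6 then 3 else
  if i % 7 = 3 ∨ i % 7 = 5 then 2 else 1

theorem one_le_perSeq (i : ℤ) : 1 ≤ perSeq i := by
  unfold perSeq; split_ifs <;> norm_num

theorem perSeq_one_sub (i : ℤ) : perSeq (1 - i) = perSeq i := by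
  unfold perSeq; grind

theorem lamCF_perSeq_one_sub (i : ℤ) : lamCF perSeq (1 - i) = lamCF perSeq i := by
  have h1 : ∀ n : ℕ, perSeq (1 - i + 1 + n) = perSeq (i - 1 - n) := fun n => by
    rw [← perSeq_one_sub]; congr 1; ring
  have h2 : ∀ n : ℕ, perSeq (1 - i - 1 - n) = perSeq (i + 1 + n) := fun n => by
    rw [← perSeq_one_sub]; congr 1; ring
  simp only [lamCF, h1, h2, perSeq_one_sub]
  ring

theorem lamCF_perSeq_add (i k : ℤ) : lamCF perSeq (i + 7 * k) = lamCF perSeq i := by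
  have h : ∀ j l : ℤ, j = l + 7 * k → perSeq j = perSeq l := by
    rintro _ l rfl; simp [perSeq]
  have h1 : ∀ n : ℕ, perSeq (i + 7 * k + 1 + n) = perSeq (i + 1 + n) := fun n =>
    h _ _ (by ring)
  have h2 : ∀ n : ℕ, perSeq (i + 7 * k - 1 - n) = perSeq (i - 1 - n) := fun n =>
    h _ _ (by ring)
  simp only [lamCF, h1, h2, h _ _ rfl]

theorem lamCF_perSeq_zero_mem : lamCF perSeq 0 ∈ Ioo (4.5281 : ℝ) 4.5308 := by
  have hA : ∀ k : ℤ, ∀ n : ℕ, 1 ≤ perSeq (k + n) := fun k n => one_le_perSeq _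
  have hB : ∀ k : ℤ, ∀ n : ℕ, 1 ≤ perSeq (k - n) := fun k n => one_le_perSeq _
  have sA : ∀ k l : ℤ, l = k + 1 → ∀ p q : ℝ, 0 ≤ p →
      cfVal (fun n => perSeq (l + n)) ∈ Icc p q →
      cfVal (fun n => perSeq (k + n)) ∈ Icc (1 / (perSeq k + q)) (1 / (perSeq k + p)) := by
    rintro k _ rfl p q hp h
    refine cfVal_mem_Icc_of_tail (hA k) (by simp) hp ?_
    convert h using 4
    push_cast; ring
  have sB : ∀ k l : ℤ, l = k - 1 → ∀ p q : ℝ, 0 ≤ p →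
      cfVal (fun n => perSeq (l - n)) ∈ Icc p q →
      cfVal (fun n => perSeq (k - n)) ∈ Icc (1 / (perSeq k + q)) (1 / (perSeq k + p)) := by
    rintro k _ rfl p q hp h
    refine cfVal_mem_Icc_of_tail (hB k) (by simp) hp ?_
    convert h using 4
    push_cast; ring
  have a := sA 1 2 rfl _ _ (by positivity) <| sA 2 3 rfl _ _ (by positivity) <|
    sA 3 4 rfl _ _ (by positivity) <|
    sA 4 5 rfl _ _ (by positivity) <| sA 5 6 rfl _ _ le_rfl <| cfVal_mem_Icc (hA _)
  have b := sB (-1) (-2) rfl _ _ (by positivity) <| sB (-2) (-3) rfl _ _ (by positivity) <|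
    sB (-3) (-4) rfl _ _ (by positivity) <| sB (-4) (-5) rfl _ _ (by positivity) <|
    sB (-5) (-6) rfl _ _ le_rfl <| cfVal_mem_Icc (hB _)
  norm_num [perSeq] at a b
  simp only [lamCF, zero_add, zero_sub]
  norm_num [perSeq]
  constructor <;> linarith [a.1, a.2, b.1, b.2]

theorem lamCF_perSeq_le (i : ℤ) : lamCF perSeq i ≤ lamCF perSeq 0 := by
  have h0 := lamCF_perSeq_zero_mem.1
  have hi : i = i % 7 + 7 * (i / 7) := (Int.emod_add_mul_ediv i 7).symm
  rw [hi, lamCF_perSeq_add]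
  have hlo := Int.emod_nonneg i (by norm_num : (7 : ℤ) ≠ 0)
  have hhi := Int.emod_lt_of_pos i (by norm_num : (0 : ℤ) < 7)
  generalize i % 7 = r at hlo hhi
  have small : ∀ j, perSeq j ≤ 2 → lamCF perSeq j ≤ lamCF perSeq 0 := by
    intro j hj
    have : (perSeq j : ℝ) ≤ 2 := mod_cast hj
    have h1 := (cfVal_mem_Icc (a := fun n : ℕ => perSeq (j + 1 + n)) fun n => one_le_perSeq _).2
    have h2 := (cfVal_mem_Icc (a := fun n : ℕ => perSeq (j - 1 - n)) fun n => one_le_perSeq _).2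
    have h3 : lamCF perSeq j ≤ 4 := by rw [lamCF]; linarith
    norm_num at h0
    linarith
  have two : lamCF perSeq 2 ≤ lamCF perSeq 0 := by
    have h1 := (cfVal_mem_Icc_of_tail (a := fun n : ℕ => perSeq (2 + 1 + n))
      (fun n => one_le_perSeq _) rfl le_rfl (cfVal_mem_Icc fun n => one_le_perSeq _)).2
    have h2 := (cfVal_mem_Icc_of_tail (a := fun n : ℕ => perSeq (2 - 1 - n))
      (fun n => one_le_perSeq _) rfl le_rfl (cfVal_mem_Icc fun n => one_le_perSeq _)).2
    have h3 : perSeq 2 = 3 := by norm_num [perSeq]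
    have h4 : perSeq (2 + 1 + (0 : ℕ)) = 2 := by norm_num [perSeq]
    have h5 : perSeq (2 - 1 - (0 : ℕ)) = 4 := by norm_num [perSeq]
    rw [h4] at h1
    rw [h5] at h2
    have h6 : lamCF perSeq 2 ≤ 4 := by
      rw [lamCF, h3]
      norm_num at h1 h2 ⊢
      linarith
    norm_num at h0
    linarith
  interval_cases r
  · exact le_rfl
  · exact (lamCF_perSeq_one_sub 0).le
  · exact two
  · exact small _ (by norm_num [perSeq])
  · exact small _ (by norm_num [perSeq])
  · exact small _ (by norm_num [perSeq])
  · calc lamCF perSeq 6 = lamCF perSeq (1 - 2 + 7 * 1) := by norm_num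
      _ = lamCF perSeq 2 := by rw [lamCF_perSeq_add, lamCF_perSeq_one_sub]
      _ ≤ lamCF perSeq 0 := two

theorem lamCF_perSeq_zero_mem_LSpec : lamCF perSeq 0 ∈ LSpec := by
  have hb : IsBoundedUnder (· ≤ ·) atTop (lamCF perSeq) := isBoundedUnder_of ⟨_, lamCF_perSeq_le⟩
  refine ⟨perSeq, one_le_perSeq, hb, le_antisymm ?_ ?_⟩
  · refine le_limsup_of_frequently_le (frequently_atTop.2 fun N => ⟨0 + 7 * |N|, ?_, ?_⟩) hb
    · have := le_abs_self N
      have := abs_nonneg N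
      lia
    · rw [lamCF_perSeq_add]
  · exact limsup_le_of_le (isCoboundedUnder_lamCF one_le_perSeq) (.of_forall lamCF_perSeq_le)

/-- The initial-segment property fails for `k = 3`: `L(3)` is a proper subset of
`L ∩ (-∞, √21]`, i.e. there is `x ∈ L` with `x ≤ √21 = √(3² + 4·3)` and `x ∉ L(3)`. -/
theorem lagrange_initial_segment_fails_three :
    LSpecK 3 ⊂ LSpec ∩ Set.Iic (Real.sqrt 21) ∧
    ∃ x ∈ LSpec, x ≤ Real.sqrt 21 ∧ x ∉ LSpecK 3 := by
  obtain ⟨h1, h2⟩ := lamCF_perSeq_zero_mem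
  have hx := lamCF_perSeq_zero_mem_LSpec
  have hle : lamCF perSeq 0 ≤ √21 := h2.le.trans (Real.le_sqrt_of_sq_le (by norm_num))
  have hnot := notMem_LSpecK_three h1 h2
  exact ⟨ssubset_iff_exists.2 ⟨LSpecK_three_subset, _, ⟨hx, hle⟩, hnot⟩, _, hx, hle, hnot⟩
end
end

section
/- Let w = (w_1,…,w_r) be a finite word with digits in {1,2,3,4}, r ≥ 1, and w_r ∈ {3,4}. Define G1(w) = |[0; w, 1, \overline{1,3}] − [0; w, 2, \overline{3,1}]|, G2(w) = |[0; w, 2, \overline{1,3}] − [0; w, 3, 4, \overline{1,3}]|, and G3(w) = |[0; w, 3, \overline{1,3}] − [0; w, 4, 4, \overline{1,3}]|. Then G3(w) < G2(w) < G1(w). Moreover, if r ≥ 2 and w* = (w_1,…,w_{r−1}), then: if w_{r−1} ∈ {3,4} then G1(w) < G3(w*), and if w_{r−1} ∈ {1,2} then G1(w) < G2(w*). -/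
open Filter Set
open scoped Pointwise

noncomputable section

/-- The periodic sequence `\overline{1,3}`. -/
def per13 : ℕ → ℕ := fun n => if n % 2 = 0 then 1 else 3

/-- The periodic sequence `\overline{3,1}`. -/
def per31 : ℕ → ℕ := fun n => if n % 2 = 0 then 3 else 1

/-- `G1(w) = |[0; w, 1, \overline{1,3}] - [0; w, 2, \overline{3,1}]|`. -/
def G1 (w : List ℕ) : ℝ :=
  |cfVal (app (w ++ [1]) per13) - cfVal (app (w ++ [2]) per31)|

/-- `G2(w) = |[0; w, 2, \overline{1,3}] - [0; w, 3, 4, \overline{1,3}]|`. -/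
def G2 (w : List ℕ) : ℝ :=
  |cfVal (app (w ++ [2]) per13) - cfVal (app (w ++ [3, 4]) per13)|

/-- `G3(w) = |[0; w, 3, \overline{1,3}] - [0; w, 4, 4, \overline{1,3}]|`. -/
def G3 (w : List ℕ) : ℝ :=
  |cfVal (app (w ++ [3]) per13) - cfVal (app (w ++ [4, 4]) per13)|

/-- The value `[0; w + t]` of the finite continued fraction with word `w` and tail `t`. -/
def cfTail (w : List ℕ) (t : ℝ) : ℝ := w.foldr (fun d x => 1 / ((d : ℝ) + x)) t

lemma cfTail_append_singleton (w : List ℕ) (d : ℕ) (t : ℝ) :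
    cfTail (w ++ [d]) t = cfTail w (1 / ((d : ℝ) + t)) := by
  simp [cfTail]

lemma cfTail_nonneg (w : List ℕ) {t : ℝ} (ht : 0 ≤ t) : 0 ≤ cfTail w t := by
  induction w with
  | nil => exact ht
  | cons d w ih =>
    change 0 ≤ 1 / ((d : ℝ) + cfTail w t)
    positivity

lemma cfConv_nonneg (n : ℕ) (a : ℕ → ℕ) : 0 ≤ cfConv n a := by
  induction n generalizing a with
  | zero => exact le_rfl
  | succ n ih =>
    have := ih fun i => a (i + 1)
    rw [cfConv]
    positivity

lemma app_nil (θ : ℕ → ℕ) : app [] θ = θ := by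
  funext n
  simp [app]

lemma app_cons_zero (d : ℕ) (w : List ℕ) (θ : ℕ → ℕ) : app (d :: w) θ 0 = d := by
  simp [app]

lemma app_cons_succ (d : ℕ) (w : List ℕ) (θ : ℕ → ℕ) :
    (fun i => app (d :: w) θ (i + 1)) = app w θ := by
  funext n
  simp [app]

lemma tendsto_cfConv_app {θ : ℕ → ℕ} {t : ℝ} (ht : 0 ≤ t)
    (h : Tendsto (fun n => cfConv n θ) atTop (nhds t)) (w : List ℕ) (hw : ∀ d ∈ w, 1 ≤ d) :
    Tendsto (fun n => cfConv n (app w θ)) atTop (nhds (cfTail w t)) := by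
  induction w with
  | nil => simpa [app_nil, cfTail] using h
  | cons d w ih =>
    have ih' := ih fun e he => hw e (List.mem_cons_of_mem _ he)
    have hd : (1 : ℝ) ≤ d := by exact_mod_cast hw d List.mem_cons_self
    have hne : (d : ℝ) + cfTail w t ≠ 0 := by
      have := cfTail_nonneg w ht
      positivity
    rw [← tendsto_add_atTop_iff_nat 1]
    simp only [cfConv, app_cons_zero, app_cons_succ]
    exact tendsto_const_nhds.div (tendsto_const_nhds.add ih') hne

lemma cfVal_app {θ : ℕ → ℕ} {t : ℝ} (ht : 0 ≤ t)
    (h : Tendsto (fun n => cfConv n θ) atTop (nhds t)) (w : List ℕ) (hw : ∀ d ∈ w, 1 ≤ d) :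
    cfVal (app w θ) = cfTail w t :=
  (tendsto_cfConv_app ht h w hw).limUnder_eq

lemma abs_one_div_add_sub_le {d x y : ℝ} (hd : 1 ≤ d) (hx : 0 ≤ x) (hy : 0 ≤ y)
    (hdy : 5 / 4 ≤ d + y) :
    |1 / (d + x) - 1 / (d + y)| ≤ 4 / 5 * |x - y| := by
  have h1 : 1 / (d + x) - 1 / (d + y) = (y - x) / ((d + x) * (d + y)) := by
    field_simp
    ring
  rw [h1, abs_div, abs_sub_comm y x, abs_of_pos (by positivity : 0 < (d + x) * (d + y)),
    div_le_iff₀ (by positivity)]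
  nlinarith [abs_nonneg (x - y), mul_le_mul (by linarith : 1 ≤ d + x) hdy (by norm_num)
    (by positivity)]

lemma per13_tail : (fun i => per13 (i + 1)) = per31 := by
  funext n
  simp only [per13, per31]
  split_ifs <;> omega

lemma per31_tail : (fun i => per31 (i + 1)) = per13 := by
  funext n
  simp only [per13, per31]
  split_ifs <;> omega

/-- The value of `[0; \overline{3,1}]`; that of `[0; \overline{1,3}]` is three times as large. -/
def val31 : ℝ := (√21 - 3) / 6

lemma val31_bounds : 0.2637 < val31 ∧ val31 < 0.2638 := by
  have h1 : (4.5822 : ℝ) < √21 := Real.lt_sqrt_of_sq_lt (by norm_num)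
  have h2 : √21 < (4.5828 : ℝ) := (Real.sqrt_lt' (by norm_num)).2 (by norm_num)
  constructor <;> rw [val31] <;> linarith

lemma val31_quadratic : 3 * val31 * (1 + val31) = 1 := by
  have : √21 ^ 2 = (21 : ℝ) := Real.sq_sqrt (by norm_num)
  rw [val31]
  linarith

lemma abs_cfConv_per_sub_le (n : ℕ) :
    |cfConv n per13 - 3 * val31| ≤ (4 / 5) ^ n ∧ |cfConv n per31 - val31| ≤ (4 / 5) ^ n := by
  obtain ⟨hl, hu⟩ := val31_bounds
  have hq := val31_quadratic
  induction n with
  | zero =>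
    simp only [cfConv, pow_zero]
    constructor <;> rw [abs_le] <;> constructor <;> linarith
  | succ n ih =>
    have e1 : 3 * val31 = 1 / (1 + val31) := by
      rw [eq_div_iff (by positivity)]
      linarith
    have e2 : val31 = 1 / (3 + 3 * val31) := by
      rw [eq_div_iff (by positivity)]
      linarith
    have p0 : (per13 0 : ℝ) = 1 := by simp [per13]
    have p1 : (per31 0 : ℝ) = 3 := by simp [per31]
    simp only [cfConv, per13_tail, per31_tail, p0, p1, pow_succ]
    constructor
    · have h := abs_one_div_add_sub_le le_rfl (cfConv_nonneg n per31)
        (by linarith : 0 ≤ val31) (by linarith)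
      rw [← e1] at h
      linarith [ih.2]
    · have h := abs_one_div_add_sub_le (by norm_num : (1 : ℝ) ≤ 3) (cfConv_nonneg n per13)
        (by linarith : 0 ≤ 3 * val31) (by linarith)
      rw [← e2] at h
      linarith [ih.1]

lemma tendsto_of_abs_sub_le_pow {u : ℕ → ℝ} {t : ℝ} (h : ∀ n, |u n - t| ≤ (4 / 5) ^ n) :
    Tendsto u atTop (nhds t) :=
  tendsto_iff_norm_sub_tendsto_zero.2 <| squeeze_zero (fun _ => norm_nonneg _) h
    (tendsto_pow_atTop_nhds_zero_of_lt_one (by norm_num) (by norm_num))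

lemma tendsto_cfConv_per13 : Tendsto (fun n => cfConv n per13) atTop (nhds (3 * val31)) :=
  tendsto_of_abs_sub_le_pow fun n => (abs_cfConv_per_sub_le n).1

lemma tendsto_cfConv_per31 : Tendsto (fun n => cfConv n per31) atTop (nhds val31) :=
  tendsto_of_abs_sub_le_pow fun n => (abs_cfConv_per_sub_le n).2

/-- A finite continued fraction is a unimodular Möbius function of its tail. -/
lemma exists_cfTail_eq_moebius (w : List ℕ) (hw : ∀ d ∈ w, 1 ≤ d) :
    ∃ p p' q q' : ℝ, 0 < q ∧ 0 ≤ q' ∧ q' ≤ q ∧ |p' * q - p * q'| = 1 ∧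
      ∀ t, 0 ≤ t → cfTail w t = (p + t * p') / (q + t * q') := by
  induction w using List.reverseRecOn with
  | nil => exact ⟨0, 1, 1, 0, by norm_num, by norm_num, by norm_num, by norm_num, by
      intro t _
      simp [cfTail]⟩
  | append_singleton w d ih =>
    obtain ⟨p, p', q, q', hq, hq', hle, hdet, h⟩ :=
      ih fun e he => hw e (List.mem_append_left _ he)
    have hd : (1 : ℝ) ≤ d := by exact_mod_cast hw d (by simp)
    refine ⟨p * d + p', p, q * d + q', q, by positivity, hq.le, by nlinarith, ?_, ?_⟩
    · rw [← hdet, abs_sub_comm]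
      congr 1
      ring
    · intro t ht
      rw [cfTail_append_singleton, h _ (by positivity)]
      field_simp
      ring

lemma exists_abs_cfTail_sub (w : List ℕ) (hw : ∀ d ∈ w, 1 ≤ d) :
    ∃ q q' : ℝ, 0 < q ∧ 0 ≤ q' ∧ q' ≤ q ∧ ∀ t s, 0 ≤ t → 0 ≤ s →
      |cfTail w t - cfTail w s| = |t - s| / ((q + t * q') * (q + s * q')) := by
  obtain ⟨p, p', q, q', hq, hq', hle, hdet, h⟩ := exists_cfTail_eq_moebius w hw
  refine ⟨q, q', hq, hq', hle, fun t s ht hs => ?_⟩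
  have e : (p + t * p') / (q + t * q') - (p + s * p') / (q + s * q') =
      ((t - s) * (p' * q - p * q')) / ((q + t * q') * (q + s * q')) := by
    field_simp
    ring
  rw [h t ht, h s hs, e, abs_div, abs_mul, hdet, mul_one,
    abs_of_pos (by positivity : 0 < (q + t * q') * (q + s * q'))]

lemma add_mul_mul_one_add_le {q q' u T : ℝ} (hle : q' ≤ q) (huT : u ≤ T) :
    (q + T * q') * (1 + u) ≤ (q + u * q') * (1 + T) := by
  nlinarith [mul_nonneg (sub_nonneg.2 hle) (sub_nonneg.2 huT)]

/-- Comparison of two gaps below `w` from bounds on the tails. -/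
lemma abs_cfTail_sub_lt (w : List ℕ) (hw : ∀ d ∈ w, 1 ≤ d) {t s t' s' : ℝ} (u v T S D D' : ℝ)
    (hu : 0 ≤ u) (hv : 0 ≤ v) (hut : u ≤ t) (hvs : v ≤ s) (hut' : u ≤ t') (hvs' : v ≤ s')
    (htT : t' ≤ T) (hsS : s' ≤ S) (hD : |t - s| ≤ D) (hD' : D' ≤ |t' - s'|)
    (hlt : D * ((1 + T) * (1 + S)) < D' * ((1 + u) * (1 + v))) :
    |cfTail w t - cfTail w s| < |cfTail w t' - cfTail w s'| := by
  obtain ⟨q, q', hq, hq', hle, h⟩ := exists_abs_cfTail_sub w hw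
  have hD0 : 0 ≤ D := (abs_nonneg _).trans hD
  have hT : 0 ≤ T := by linarith
  have hS : 0 ≤ S := by linarith
  have hD0' : 0 < D' := by
    by_contra! hn
    have : D' * ((1 + u) * (1 + v)) ≤ 0 := mul_nonpos_of_nonpos_of_nonneg hn (by positivity)
    have : 0 ≤ D * ((1 + T) * (1 + S)) := by positivity
    linarith
  rw [h t s (hu.trans hut) (hv.trans hvs), h t' s' (hu.trans hut') (hv.trans hvs')]
  calc |t - s| / ((q + t * q') * (q + s * q'))
      ≤ D / ((q + u * q') * (q + v * q')) := by
        have : 0 ≤ t := hu.trans hut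
        gcongr
    _ < D' / ((q + T * q') * (q + S * q')) := by
        rw [div_lt_div_iff₀ (by positivity) (by positivity)]
        have h1 := mul_le_mul (add_mul_mul_one_add_le hle (hut'.trans htT))
          (add_mul_mul_one_add_le hle (hvs'.trans hsS)) (by positivity) (by positivity)
        have h2 := mul_lt_mul_of_pos_right hlt
          (by positivity : 0 < (q + u * q') * (q + v * q'))
        refine lt_of_mul_lt_mul_right ?_ (by positivity : 0 ≤ (1 + u) * (1 + v))
        calc D * ((q + T * q') * (q + S * q')) * ((1 + u) * (1 + v))
            = D * ((q + T * q') * (1 + u) * ((q + S * q') * (1 + v))) := by ring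
          _ ≤ D * ((q + u * q') * (1 + T) * ((q + v * q') * (1 + S))) := by gcongr
          _ = D * ((1 + T) * (1 + S)) * ((q + u * q') * (q + v * q')) := by ring
          _ < D' * ((1 + u) * (1 + v)) * ((q + u * q') * (q + v * q')) := h2
          _ = _ := by ring
    _ ≤ |t' - s'| / ((q + t' * q') * (q + s' * q')) := by
        have : 0 ≤ t' := hu.trans hut'
        have : 0 ≤ s' := hv.trans hvs'
        gcongr

lemma one_div_mem_Icc {x l u l' u' : ℝ} (hl : l ≤ x) (hu : x ≤ u) (h0 : 0 < l)
    (h1 : l' * u ≤ 1) (h2 : 1 ≤ u' * l) : l' ≤ 1 / x ∧ 1 / x ≤ u' := by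
  have hx : 0 < x := h0.trans_le hl
  constructor
  · calc l' ≤ 1 / u := (le_div_iff₀ (hx.trans_le hu)).2 h1
      _ ≤ 1 / x := one_div_le_one_div_of_le hx hu
  · exact (one_div_le_one_div_of_le h0 hl).trans ((div_le_iff₀ h0).2 h2)

lemma G1_eq (w : List ℕ) (hw : ∀ d ∈ w, 1 ≤ d) :
    G1 w = |cfTail w (1 / (1 + 3 * val31)) - cfTail w (1 / (2 + val31))| := by
  have h0 := val31_bounds.1
  rw [G1, cfVal_app (by linarith) tendsto_cfConv_per13 _ (by simpa [or_imp, forall_and] using hw),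
    cfVal_app (by linarith) tendsto_cfConv_per31 _ (by simpa [or_imp, forall_and] using hw)]
  simp [cfTail]

lemma G2_eq (w : List ℕ) (hw : ∀ d ∈ w, 1 ≤ d) :
    G2 w = |cfTail w (1 / (2 + 3 * val31)) - cfTail w (1 / (3 + 1 / (4 + 3 * val31)))| := by
  have h0 := val31_bounds.1
  rw [G2, cfVal_app (by linarith) tendsto_cfConv_per13 _ (by simpa [or_imp, forall_and] using hw),
    cfVal_app (by linarith) tendsto_cfConv_per13 _ (by simpa [or_imp, forall_and] using hw)]
  simp [cfTail]

lemma G3_eq (w : List ℕ) (hw : ∀ d ∈ w, 1 ≤ d) :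
    G3 w = |cfTail w (1 / (3 + 3 * val31)) - cfTail w (1 / (4 + 1 / (4 + 3 * val31)))| := by
  have h0 := val31_bounds.1
  rw [G3, cfVal_app (by linarith) tendsto_cfConv_per13 _ (by simpa [or_imp, forall_and] using hw),
    cfVal_app (by linarith) tendsto_cfConv_per13 _ (by simpa [or_imp, forall_and] using hw)]
  simp [cfTail]

lemma G1_tail_bounds : (0.558 ≤ 1 / (1 + 3 * val31) ∧ 1 / (1 + 3 * val31) ≤ 0.559) ∧
    0.441 ≤ 1 / (2 + val31) ∧ 1 / (2 + val31) ≤ 0.442 := by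
  obtain ⟨hl, hu⟩ := val31_bounds
  constructor
  · apply one_div_mem_Icc (l := 1.791) (u := 1.792) <;> linarith
  · apply one_div_mem_Icc (l := 2.2637) (u := 2.2638) <;> linarith

lemma one_div_four_add_bounds :
    0.208 ≤ 1 / (4 + 3 * val31) ∧ 1 / (4 + 3 * val31) ≤ 0.209 := by
  obtain ⟨hl, hu⟩ := val31_bounds
  apply one_div_mem_Icc (l := 4.791) (u := 4.792) <;> linarith

lemma G2_tail_bounds : (0.358 ≤ 1 / (2 + 3 * val31) ∧ 1 / (2 + 3 * val31) ≤ 0.359) ∧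
    0.311 ≤ 1 / (3 + 1 / (4 + 3 * val31)) ∧ 1 / (3 + 1 / (4 + 3 * val31)) ≤ 0.312 := by
  obtain ⟨hl, hu⟩ := val31_bounds
  obtain ⟨hl', hu'⟩ := one_div_four_add_bounds
  constructor
  · apply one_div_mem_Icc (l := 2.791) (u := 2.792) <;> linarith
  · apply one_div_mem_Icc (l := 3.208) (u := 3.209) <;> linarith

lemma G3_tail_bounds : (0.263 ≤ 1 / (3 + 3 * val31) ∧ 1 / (3 + 3 * val31) ≤ 0.264) ∧
    0.237 ≤ 1 / (4 + 1 / (4 + 3 * val31)) ∧ 1 / (4 + 1 / (4 + 3 * val31)) ≤ 0.238 := by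
  obtain ⟨hl, hu⟩ := val31_bounds
  obtain ⟨hl', hu'⟩ := one_div_four_add_bounds
  constructor
  · apply one_div_mem_Icc (l := 3.791) (u := 3.792) <;> linarith
  · apply one_div_mem_Icc (l := 4.208) (u := 4.209) <;> linarith

lemma G3_lt_G2 (w : List ℕ) (hw : ∀ d ∈ w, 1 ≤ d) : G3 w < G2 w := by
  obtain ⟨⟨a1, a2⟩, a3, a4⟩ := G3_tail_bounds
  obtain ⟨⟨b1, b2⟩, b3, b4⟩ := G2_tail_bounds
  rw [G3_eq w hw, G2_eq w hw]
  refine abs_cfTail_sub_lt w hw 0.263 0.237 0.359 0.312 0.027 0.046 (by norm_num) (by norm_num)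
    a1 a3 (by linarith) (by linarith) b2 b4 (abs_le.2 ⟨by linarith, by linarith⟩)
    (le_abs.2 (Or.inl (by linarith))) (by norm_num)

lemma G2_lt_G1 (w : List ℕ) (hw : ∀ d ∈ w, 1 ≤ d) : G2 w < G1 w := by
  obtain ⟨⟨a1, a2⟩, a3, a4⟩ := G2_tail_bounds
  obtain ⟨⟨b1, b2⟩, b3, b4⟩ := G1_tail_bounds
  rw [G2_eq w hw, G1_eq w hw]
  refine abs_cfTail_sub_lt w hw 0.358 0.311 0.559 0.442 0.048 0.116 (by norm_num) (by norm_num)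
    a1 a3 (by linarith) (by linarith) b2 b4 (abs_le.2 ⟨by linarith, by linarith⟩)
    (le_abs.2 (Or.inl (by linarith))) (by norm_num)

lemma G1_append_singleton_lt_G3 (w : List ℕ) (hw : ∀ d ∈ w, 1 ≤ d) (d : ℕ) (hd : 3 ≤ d) :
    G1 (w ++ [d]) < G3 w := by
  have hd' : (3 : ℝ) ≤ d := by exact_mod_cast hd
  obtain ⟨⟨a1, a2⟩, a3, a4⟩ := G1_tail_bounds
  obtain ⟨⟨b1, b2⟩, b3, b4⟩ := G3_tail_bounds
  have hwd : ∀ e ∈ w ++ [d], 1 ≤ e := by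
    simp only [List.mem_append, List.mem_singleton]
    rintro e (he | rfl)
    · exact hw e he
    · omega
  rw [G1_eq _ hwd, G3_eq w hw, cfTail_append_singleton, cfTail_append_singleton]
  generalize 1 / (1 + 3 * val31) = x at *
  generalize 1 / (2 + val31) = y at *
  have hgap : |1 / ((d : ℝ) + x) - 1 / (d + y)| ≤ 0.0132 := by
    have hx : 0 < (d : ℝ) + x := by linarith
    have hy : 0 < (d : ℝ) + y := by linarith
    have e : 1 / ((d : ℝ) + x) - 1 / (d + y) = (y - x) / ((d + x) * (d + y)) := by
      field_simp
      ring
    rw [e, abs_div, abs_of_pos (mul_pos hx hy), abs_of_nonpos (by linarith),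
      div_le_iff₀ (mul_pos hx hy)]
    nlinarith [mul_le_mul (by linarith : (3 : ℝ) ≤ d + x) (by linarith : (3 : ℝ) ≤ d + y)
      (by norm_num) hx.le]
  exact abs_cfTail_sub_lt w hw 0 0 0.264 0.238 0.0132 0.025 le_rfl le_rfl
    (by have : 0 < (d : ℝ) + x := by linarith
        positivity)
    (by have : 0 < (d : ℝ) + y := by linarith
        positivity)
    (by linarith) (by linarith) b2 b4 hgap (le_abs.2 (Or.inl (by linarith))) (by norm_num)

/-- For a word `w` with digits in `{1,2,3,4}` whose last digit is `3` or `4`: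
`G3(w) < G2(w) < G1(w)`; moreover, if `w` has length at least `2` and `w*` denotes
`w` with its last digit removed, then `G1(w) < G3(w*)` when the second-to-last digit
of `w` is `3` or `4`, and `G1(w) < G2(w*)` when it is `1` or `2`. -/
theorem gap_comparison_last_34 (w : List ℕ) (hw : w ≠ [])
    (hdig : ∀ d ∈ w, d ∈ ({1, 2, 3, 4} : Set ℕ))
    (hlast : w.getLast hw ∈ ({3, 4} : Set ℕ)) :
    (G3 w < G2 w ∧ G2 w < G1 w) ∧
    ∀ hw' : w.dropLast ≠ [],
      (w.dropLast.getLast hw' ∈ ({3, 4} : Set ℕ) → G1 w < G3 w.dropLast) ∧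
      (w.dropLast.getLast hw' ∈ ({1, 2} : Set ℕ) → G1 w < G2 w.dropLast) := by
  have hpos : ∀ d ∈ w, 1 ≤ d := fun d hd => by
    have := hdig d hd
    simp only [Set.mem_insert_iff, Set.mem_singleton_iff] at this
    omega
  have hpos' : ∀ d ∈ w.dropLast, 1 ≤ d := fun d hd => hpos d (List.mem_of_mem_dropLast hd)
  have hlast' : 3 ≤ w.getLast hw := by
    simp only [Set.mem_insert_iff, Set.mem_singleton_iff] at hlast
    omega
  have key : G1 w < G3 w.dropLast := by
    have := G1_append_singleton_lt_G3 w.dropLast hpos' _ hlast'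
    rwa [List.dropLast_append_getLast hw] at this
  exact ⟨⟨G3_lt_G2 w hpos, G2_lt_G1 w hpos⟩, fun _ =>
    ⟨fun _ => key, fun _ => key.trans (G3_lt_G2 _ hpos')⟩⟩
end
end
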